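/- Let F ∈ ℂ[X,Y,Z] be an irreducible homogeneous polynomial of degree d ≥ 3 whose curve F = 0 has only nodes as singularities. If a, b, c ∈ ℂ[X,Y,Z] are homogeneous of the same degree m ≤ d − 2 and satisfy a·F_X + b·F_Y + c·F_Z = 0, then a = b = c = 0. (Equivalently, the partial derivatives F_X, F_Y, F_Z admit no nonzero syzygy in degrees ≤ d − 2.) -/

import Mathlib

open MvPolynomial

noncomputable section

/-- The complex projective plane. -/
abbrev P2 : Type := Projectivization ℂ (Fin 3 → ℂ)

/-- A (homogeneous) polynomial `G` vanishes at a point `p ∈ ℙ²`. -/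
def VanAt (G : MvPolynomial (Fin 3) ℂ) (p : P2) : Prop :=
  eval p.rep G = 0

/-- The submodule of polynomials vanishing at every point of `S`. -/
def vanishing (S : Set P2) : Submodule ℂ (MvPolynomial (Fin 3) ℂ) where
  carrier := {G | ∀ p ∈ S, VanAt G p}
  add_mem' := by
    intro a b ha hb p hp
    have h1 := ha p hp
    have h2 := hb p hp
    simp only [VanAt] at h1 h2 ⊢
    simp [h1, h2]
  zero_mem' := by
    intro p hp
    simp [VanAt]
  smul_mem' := by
    intro c G hG p hp
    have h1 := hG p hp
    simp only [VanAt] at h1 ⊢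
    simp [h1]

/-- `V_k(S)`: homogeneous polynomials of degree `k` (together with `0`)
vanishing at every point of `S`. -/
def Vsp (k : ℕ) (S : Set P2) : Submodule ℂ (MvPolynomial (Fin 3) ℂ) :=
  homogeneousSubmodule (Fin 3) ℂ k ⊓ vanishing S

/-- `p` is a singular point of the curve `F = 0`. -/
def SingPt (F : MvPolynomial (Fin 3) ℂ) (p : P2) : Prop :=
  ∀ i : Fin 3, eval p.rep (pderiv i F) = 0

/-- `p` is a node of the curve `F = 0`. -/
def IsNode (F : MvPolynomial (Fin 3) ℂ) (p : P2) : Prop :=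
  SingPt F p ∧
    (Matrix.of fun i j : Fin 3 => eval p.rep (pderiv i (pderiv j F))).rank = 2

/-- The curve `F = 0` is nodal: every singular point is a node. -/
def Nodal (F : MvPolynomial (Fin 3) ℂ) : Prop :=
  ∀ p : P2, SingPt F p → IsNode F p

/-- The set of nodes of the curve `F = 0`. -/
def nodes (F : MvPolynomial (Fin 3) ℂ) : Set P2 :=
  {p | IsNode F p}

/-- The common zero set in `ℙ²` of two polynomials. -/
def zeroSet (F₁ F₂ : MvPolynomial (Fin 3) ℂ) : Set P2 :=
  {p | VanAt F₁ p ∧ VanAt F₂ p}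


lemma aeval_mul_hom {B : Type*} [CommRing B] [Algebra ℂ B] {e : ℕ}
    {G : MvPolynomial (Fin 3) ℂ} (hG : G.IsHomogeneous e) (r : B) (x : Fin 3 → B) :
    aeval (fun i => r * x i) G = r ^ e * aeval x G := by
  rw [aeval_def, aeval_def, eval₂_eq', eval₂_eq', Finset.mul_sum]
  refine Finset.sum_congr rfl fun s hs => ?_
  have h1 := hG.degree_eq_sum_deg_support hs
  simp only [mul_pow, Finset.prod_mul_distrib, Finset.prod_pow_eq_pow_sum]
  have h2 : ∑ i, s i = e := by
    rw [h1]
    refine (Finset.sum_subset (Finset.subset_univ _) ?_).symm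
    intro i _ hi
    simpa using hi
  rw [h2]
  ring

lemma eval_smul_hom {e : ℕ} {G : MvPolynomial (Fin 3) ℂ} (hG : G.IsHomogeneous e)
    (u : ℂ) (q : Fin 3 → ℂ) : eval (u • q) G = u ^ e * eval q G := by
  have := aeval_mul_hom hG u q
  rw [aeval_eq_eval, aeval_eq_eval] at this
  exact this

/-- The linear forms cutting out the line through `q`. -/
def lin (q : Fin 3 → ℂ) (k i : Fin 3) : MvPolynomial (Fin 3) ℂ :=
  C (q k) * X i - C (q i) * X k

lemma mem_span_lin {e : ℕ} {G : MvPolynomial (Fin 3) ℂ} (hG : G.IsHomogeneous e)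
    (q : Fin 3 → ℂ) (k : Fin 3) (hk : q k ≠ 0) (h0 : eval q G = 0) :
    G ∈ Ideal.span (Set.range (lin q k)) := by
  set L := Ideal.span (Set.range (lin q k)) with hL
  let B := MvPolynomial (Fin 3) ℂ ⧸ L
  let π : MvPolynomial (Fin 3) ℂ →ₐ[ℂ] B := Ideal.Quotient.mkₐ ℂ L
  have e1 := aeval_mul_hom hG (π (C (q k))) (fun i => π (X i))
  have e2 := aeval_mul_hom hG (π (X k)) (fun i => algebraMap ℂ B (q i))
  have e3 : (fun i => π (C (q k)) * π (X i)) = fun i => π (X k) * algebraMap ℂ B (q i) := by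
    funext i
    have : π (lin q k i) = 0 :=
      Ideal.Quotient.eq_zero_iff_mem.2 (Ideal.subset_span ⟨i, rfl⟩)
    rw [lin, map_sub, map_mul, map_mul, sub_eq_zero] at this
    rw [this, mul_comm]
    congr 1
  rw [e3, e2] at e1
  have e4 : aeval (fun i => algebraMap ℂ B (q i)) G = 0 := by
    have := aeval_algebraMap_apply B q G
    rw [show (fun i => algebraMap ℂ B (q i)) = algebraMap ℂ B ∘ q from rfl, this,
      aeval_eq_eval]
    simp [h0]
  have e5 : aeval (fun i => π (X i)) G = π G := by
    have := comp_aeval_apply (R := ℂ) (fun i => (X i : MvPolynomial (Fin 3) ℂ)) π G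
    rw [← this]
    congr 1
    exact aeval_X_left_apply G
  rw [e4, e5, mul_zero] at e1
  have hu : IsUnit (π (C (q k)) ^ e) :=
    ((((isUnit_iff_ne_zero.2 hk).map C).map π)).pow e
  have := (hu.mul_right_eq_zero).1 e1.symm
  exact Ideal.Quotient.eq_zero_iff_mem.1 this

lemma pderiv_swap (i j : Fin 3) (G : MvPolynomial (Fin 3) ℂ) :
    pderiv i (pderiv j G) = pderiv j (pderiv i G) := by
  have h : ⁅(pderiv i : Derivation ℂ (MvPolynomial (Fin 3) ℂ) (MvPolynomial (Fin 3) ℂ)),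
      (pderiv j : Derivation ℂ (MvPolynomial (Fin 3) ℂ) (MvPolynomial (Fin 3) ℂ))⁆ = 0 := by
    refine MvPolynomial.derivation_ext fun k => ?_
    simp [Derivation.commutator_apply, pderiv_X, Pi.single_apply, apply_ite]
  have := congrArg (fun D => D G) h
  simpa [Derivation.commutator_apply, sub_eq_zero] using this

/-- Kernel of the Hessian at a singular point. -/
lemma ker_hess {d : ℕ} {F : MvPolynomial (Fin 3) ℂ}
    (hF : F.IsHomogeneous d) (hn : Nodal F) (q : Fin 3 → ℂ) (hq : q ≠ 0)
    (hs : ∀ i, eval q (pderiv i F) = 0) (w : Fin 3 → ℂ)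
    (hw : ∀ i, ∑ j, eval q (pderiv i (pderiv j F)) * w j = 0) : ∃ c : ℂ, w = c • q := by
  let p : P2 := Projectivization.mk ℂ q hq
  obtain ⟨u, hu⟩ := Projectivization.exists_smul_eq_mk_rep ℂ q hq
  have hu' : p.rep = (u : ℂ) • q := hu.symm
  have hsing : SingPt F p := by
    intro i
    rw [hu', eval_smul_hom hF.pderiv, hs i, mul_zero]
  have hrank := (hn p hsing).2
  set M := (Matrix.of fun i j : Fin 3 => eval p.rep (pderiv i (pderiv j F))) with hM
  have key : ∀ v : Fin 3 → ℂ, (∀ i, ∑ j, eval q (pderiv i (pderiv j F)) * v j = 0) →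
      v ∈ LinearMap.ker M.mulVecLin := by
    intro v hv
    rw [LinearMap.mem_ker]
    funext i
    have := hv i
    simp only [Matrix.mulVecLin_apply, Matrix.mulVec, dotProduct, hM, Matrix.of_apply,
      Pi.zero_apply]
    rw [hu']
    simp_rw [eval_smul_hom (hF.pderiv.pderiv), mul_assoc]
    rw [← Finset.mul_sum, this, mul_zero]
  have hqk : q ∈ LinearMap.ker M.mulVecLin := by
    apply key
    intro i
    have h1 := (hF.pderiv (i := i)).sum_X_mul_pderiv
    have h2 := congrArg (eval q) h1
    simp only [map_sum, map_mul, eval_X, nsmul_eq_mul, map_natCast, hs i, mul_zero] at h2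
    rw [← h2]
    refine Finset.sum_congr rfl fun j _ => ?_
    rw [mul_comm, pderiv_swap]
  have hfin : Module.finrank ℂ (LinearMap.ker M.mulVecLin) = 1 := by
    have := LinearMap.finrank_range_add_finrank_ker M.mulVecLin
    have h3 : Module.finrank ℂ (LinearMap.range M.mulVecLin) = 2 := hrank
    rw [h3] at this
    simp at this
    omega
  have hne : (⟨q, hqk⟩ : LinearMap.ker M.mulVecLin) ≠ 0 := by
    intro h
    exact hq (congrArg Subtype.val h)
  obtain ⟨c, hc⟩ := (finrank_eq_one_iff_of_nonzero' _ hne).1 hfin ⟨w, key w hw⟩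
  exact ⟨c, (congrArg Subtype.val hc).symm⟩

/-- The Jacobian ideal. -/
def jac (F : MvPolynomial (Fin 3) ℂ) : Ideal (MvPolynomial (Fin 3) ℂ) :=
  Ideal.span (Set.range fun i => pderiv i F)

lemma local_node {d : ℕ} {F : MvPolynomial (Fin 3) ℂ}
    (hF : F.IsHomogeneous d) (hn : Nodal F) (q : Fin 3 → ℂ) (hq : q ≠ 0)
    (hs : ∀ i, eval q (pderiv i F) = 0) {e : ℕ} {P : MvPolynomial (Fin 3) ℂ}
    (hP : P.IsHomogeneous e) (hP0 : eval q P = 0) :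
    ∃ s, eval q s ≠ 0 ∧ s * P ∈ jac F := by
  obtain ⟨k, hk⟩ : ∃ k, q k ≠ 0 := by
    by_contra! h
    exact hq (funext h)
  have hmem : ∀ i, ∃ A : Fin 3 → MvPolynomial (Fin 3) ℂ,
      ∑ j, A j * lin q k j = pderiv i F := fun i =>
    Ideal.mem_span_range_iff_exists_fun.1 (mem_span_lin hF.pderiv q k hk (hs i))
  choose A hA using hmem
  have hlk : lin q k k = 0 := by simp [lin]
  let A' : Matrix (Fin 3) (Fin 3) (MvPolynomial (Fin 3) ℂ) :=
    Matrix.of fun i j => if j = k then (if i = k then 1 else 0) else A i j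
  have hA' : A'.mulVec (lin q k) = fun i => pderiv i F := by
    funext i
    rw [← hA i]
    simp only [Matrix.mulVec, dotProduct]
    refine Finset.sum_congr rfl fun j _ => ?_
    by_cases hj : j = k
    · subst hj; simp [hlk]
    · simp [A', hj]
  refine ⟨A'.det, ?_, ?_⟩
  · intro hdet
    rw [RingHom.map_det] at hdet
    obtain ⟨w, hw0, hw⟩ := Matrix.exists_vecMul_eq_zero_iff.2 hdet
    have hw' : ∀ j, ∑ i, w i * eval q (A' i j) = 0 := fun j => by
      have := congrFun hw j
      simpa [Matrix.vecMul, dotProduct] using this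
    have hwk : w k = 0 := by
      have := hw' k
      simpa [A', apply_ite] using this
    have hlq : ∀ j, eval q (lin q k j) = 0 := fun j => by simp [lin]; ring
    have hess : ∀ l i, eval q (pderiv l (pderiv i F))
        = ∑ j, eval q (A' i j) * eval q (pderiv l (lin q k j)) := by
      intro l i
      have : pderiv i F = ∑ j, A' i j * lin q k j := (congrFun hA' i).symm
      rw [this, map_sum, map_sum]
      refine Finset.sum_congr rfl fun j _ => ?_
      rw [pderiv_mul, map_add, map_mul, map_mul, hlq j, mul_zero, zero_add]
    obtain ⟨c, hc⟩ := ker_hess hF hn q hq hs w (by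
      intro l
      simp_rw [hess, Finset.sum_mul]
      rw [Finset.sum_comm]
      refine Finset.sum_eq_zero fun j _ => ?_
      have := hw' j
      calc ∑ i, eval q (A' i j) * eval q (pderiv l (lin q k j)) * w i
          = eval q (pderiv l (lin q k j)) * ∑ i, w i * eval q (A' i j) := by
            rw [Finset.mul_sum]; exact Finset.sum_congr rfl fun i _ => by ring
        _ = 0 := by rw [this, mul_zero])
    rw [hc] at hwk
    have : c = 0 := by simpa [hk] using hwk
    apply hw0
    rw [hc, this, zero_smul]
  · have hl : ∀ j, A'.det * lin q k j ∈ jac F := by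
      intro j
      have h1 : A'.adjugate.mulVec (A'.mulVec (lin q k)) = A'.det • lin q k := by
        rw [Matrix.mulVec_mulVec, Matrix.adjugate_mul, Matrix.smul_mulVec, Matrix.one_mulVec]
      have h2 := congrFun h1 j
      rw [hA'] at h2
      simp only [Pi.smul_apply, smul_eq_mul] at h2
      rw [← h2]
      simp only [Matrix.mulVec, dotProduct]
      exact Ideal.sum_mem _ fun i _ => Ideal.mul_mem_left _ _ (Ideal.subset_span ⟨i, rfl⟩)
    obtain ⟨B, hB⟩ := Ideal.mem_span_range_iff_exists_fun.1 (mem_span_lin hP q k hk hP0)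
    rw [← hB, Finset.mul_sum]
    refine Ideal.sum_mem _ fun j _ => ?_
    rw [mul_left_comm]
    exact Ideal.mul_mem_left _ _ (hl j)

/-- A form vanishing at all singular points is in the saturation of the Jacobian ideal. -/
lemma exists_pow_sat {d : ℕ} {F : MvPolynomial (Fin 3) ℂ}
    (hF : F.IsHomogeneous d) (hn : Nodal F) {e : ℕ} {P : MvPolynomial (Fin 3) ℂ}
    (hP : P.IsHomogeneous e)
    (hP0 : ∀ q : Fin 3 → ℂ, q ≠ 0 → (∀ i, eval q (pderiv i F) = 0) → eval q P = 0) :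
    ∃ N, ∀ n, N ≤ n → ∀ h : MvPolynomial (Fin 3) ℂ, h.IsHomogeneous n → h * P ∈ jac F := by
  let K : Ideal (MvPolynomial (Fin 3) ℂ) := Submodule.comap (LinearMap.mulRight (MvPolynomial (Fin 3) ℂ) P) (jac F)
  have hK : ∀ s, s ∈ K ↔ s * P ∈ jac F := fun s => Iff.rfl
  have hrad : idealOfVars (Fin 3) ℂ ≤ K.radical := by
    rw [← vanishingIdeal_zeroLocus_eq_radical (K := ℂ) K]
    refine Ideal.span_le.2 ?_
    rintro _ ⟨i, rfl⟩
    intro q hq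
    by_cases hq0 : q = 0
    · simp [hq0]
    exfalso
    have hq' : ∀ s, s * P ∈ jac F → eval q s = 0 := fun s hs => by
      have := hq s ((hK s).2 hs)
      rwa [aeval_eq_eval] at this
    have hs : ∀ i, eval q (pderiv i F) = 0 := fun i =>
      hq' _ (Ideal.mul_mem_right _ _ (Ideal.subset_span ⟨i, rfl⟩))
    obtain ⟨s, h1, h2⟩ := local_node hF hn q hq0 hs hP (hP0 q hq0 hs)
    exact h1 (hq' s h2)
  obtain ⟨N, hN⟩ := Ideal.exists_pow_le_of_le_radical_of_fg hrad (idealOfVars_fg (Fin 3) ℂ)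
  refine ⟨N, fun n hn h hh => (hK h).1 (hN ?_)⟩
  rw [mem_pow_idealOfVars_iff']
  intro x hx
  apply hh.coeff_eq_zero
  omega

lemma comp_mul {e n : ℕ} {G : MvPolynomial (Fin 3) ℂ} (hG : G.IsHomogeneous e)
    (h : MvPolynomial (Fin 3) ℂ) :
    homogeneousComponent (n + e) (h * G) = homogeneousComponent n h * G := by
  conv_lhs => rw [← sum_homogeneousComponent h]
  rw [Finset.sum_mul, map_sum]
  have : ∀ i, homogeneousComponent (n + e) (homogeneousComponent i h * G)
      = if i = n then homogeneousComponent i h * G else 0 := by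
    intro i
    rw [homogeneousComponent_of_mem ((homogeneousComponent_isHomogeneous i h).mul hG)]
    by_cases hi : i = n
    · simp [hi]
    · rw [if_neg (by omega), if_neg hi]
  simp_rw [this]
  rw [Finset.sum_ite_eq']
  split_ifs with h1
  · rfl
  · rw [homogeneousComponent_eq_zero, zero_mul]
    simp at h1
    omega

lemma not_dvd_of_lt {d e : ℕ} {F G : MvPolynomial (Fin 3) ℂ} (hF : F.IsHomogeneous d)
    (hG : G.IsHomogeneous e) (hF0 : F ≠ 0) (hlt : e < d) (h : F ∣ G) : G = 0 := by
  by_contra hG0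
  obtain ⟨q, rfl⟩ := h
  have hq : q ≠ 0 := right_ne_zero_of_mul hG0
  have h1 := hG.totalDegree hG0
  rw [totalDegree_mul_of_isDomain hF0 hq, hF.totalDegree hF0] at h1
  omega

/-- The eigenvalue argument. -/
lemma eigen {d : ℕ} (hd : 3 ≤ d) {F : MvPolynomial (Fin 3) ℂ}
    (hF : F.IsHomogeneous d) (hirr : Irreducible F) (al : Fin 3 → MvPolynomial (Fin 3) ℂ)
    (hal : ∀ i, (al i).IsHomogeneous (d - 1))
    (hprop : ∀ i j, F ∣ pderiv i F * al j - pderiv j F * al i)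
    (n : ℕ) (hsat : ∀ i, ∀ h : MvPolynomial (Fin 3) ℂ, h.IsHomogeneous n → h * al i ∈ jac F) :
    ∃ c : ℂ, ∀ i, al i = C c * pderiv i F := by
  have hF0 : F ≠ 0 := hirr.ne_zero
  have hprime : (Ideal.span {F}).IsPrime :=
    (Ideal.span_singleton_prime hF0).2 hirr.prime
  let A := MvPolynomial (Fin 3) ℂ ⧸ Ideal.span {F}
  let Kf := FractionRing A
  let φ : MvPolynomial (Fin 3) ℂ →ₐ[ℂ] Kf :=
    (IsScalarTower.toAlgHom ℂ A Kf).comp (Ideal.Quotient.mkₐ ℂ (Ideal.span {F}))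
  have hφ : ∀ G, φ G = 0 ↔ F ∣ G := by
    intro G
    have : φ G = algebraMap A Kf (Ideal.Quotient.mk _ G) := rfl
    rw [this, IsFractionRing.to_map_eq_zero_iff, Ideal.Quotient.eq_zero_iff_mem,
      Ideal.mem_span_singleton]
  obtain ⟨j, hj⟩ : ∃ j, pderiv j F ≠ 0 := by
    by_contra! h
    have h1 := hF.sum_X_mul_pderiv
    simp only [h, mul_zero, Finset.sum_const_zero, nsmul_eq_mul] at h1
    have h2 : ((d : MvPolynomial (Fin 3) ℂ)) ≠ 0 := by
      exact_mod_cast (by omega : d ≠ 0)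
    exact (mul_ne_zero h2 hF0) h1.symm
  have hφj : φ (pderiv j F) ≠ 0 := fun h =>
    hj (not_dvd_of_lt hF hF.pderiv hF0 (by omega) ((hφ _).1 h))
  have hφX : φ (X 0) ≠ 0 := fun h =>
    X_ne_zero (R := ℂ) (0 : Fin 3) (not_dvd_of_lt hF (isHomogeneous_X ℂ 0) hF0 (by omega) ((hφ _).1 h))
  let g : Kf := φ (al j) / φ (pderiv j F)
  have hg : ∀ i, φ (al i) = g * φ (pderiv i F) := by
    intro i
    have h := (hφ _).2 (hprop i j)
    rw [map_sub, map_mul, map_mul, sub_eq_zero] at h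
    simp only [g]
    rw [div_mul_eq_mul_div, eq_div_iff hφj]
    linear_combination -h
  let W : Submodule ℂ (MvPolynomial (Fin 3) ℂ) :=
    (jac F).restrictScalars ℂ ⊓ homogeneousSubmodule (Fin 3) ℂ (n + (d - 1))
  let V : Submodule ℂ Kf := W.map φ.toLinearMap
  have : Module.Finite ℂ (homogeneousSubmodule (Fin 3) ℂ (n + (d - 1))) :=
    Module.Finite.iff_fg.2 (homogeneousSubmodule_fg _ _ _)
  have : Module.Finite ℂ W :=
    Submodule.finiteDimensional_of_le (inf_le_right : W ≤ homogeneousSubmodule (Fin 3) ℂ (n + (d - 1)))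
  have : Module.Finite ℂ V := inferInstance
  have hinv : ∀ v ∈ V, LinearMap.mulLeft ℂ g v ∈ V := by
    rintro _ ⟨P, ⟨hP1, hP2⟩, rfl⟩
    obtain ⟨h, hh⟩ := Ideal.mem_span_range_iff_exists_fun.1 hP1
    have hP3 : P = ∑ i, homogeneousComponent n (h i) * pderiv i F := by
      have h1 := homogeneousComponent_eq_self hP2
      rw [← h1, ← hh, map_sum]
      exact Finset.sum_congr rfl fun i _ => comp_mul hF.pderiv _
    refine ⟨∑ i, homogeneousComponent n (h i) * al i, ⟨?_, ?_⟩, ?_⟩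
    · exact Ideal.sum_mem _ fun i _ => hsat i _ (homogeneousComponent_isHomogeneous n _)
    · exact Submodule.sum_mem _ fun i _ => (homogeneousComponent_isHomogeneous n _).mul (hal i)
    · simp only [AlgHom.toLinearMap_apply, LinearMap.mulLeft_apply]
      conv_rhs => rw [hP3]
      simp only [map_sum, map_mul, hg]
      rw [Finset.mul_sum]
      exact Finset.sum_congr rfl fun i _ => by ring
  have hnt : Nontrivial V := by
    refine ⟨⟨⟨φ (X 0 ^ n * pderiv j F), ⟨_, ⟨?_, ?_⟩, rfl⟩⟩, 0, ?_⟩⟩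
    · exact Ideal.mul_mem_left _ _ (Ideal.subset_span ⟨j, rfl⟩)
    · exact (isHomogeneous_X_pow 0 n).mul hF.pderiv
    · intro h
      have h1 := congrArg Subtype.val h
      simp only [map_mul, map_pow, ZeroMemClass.coe_zero] at h1
      exact (mul_ne_zero (pow_ne_zero n hφX) hφj) h1
  let T : Module.End ℂ V := (LinearMap.mulLeft ℂ g).restrict hinv
  obtain ⟨c, hc⟩ := Module.End.exists_eigenvalue T
  obtain ⟨v, hv⟩ := hc.exists_hasEigenvector
  have hv1 := congrArg Subtype.val hv.apply_eq_smul
  have hv2 : (v : Kf) ≠ 0 := fun h => hv.2 (Subtype.ext h)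
  have hgc : g = φ (C c) := by
    have h1 : g * (v : Kf) = c • (v : Kf) := hv1
    have h2 : φ (C c) = algebraMap ℂ Kf c := φ.commutes c
    rw [Algebra.smul_def, ← h2] at h1
    exact mul_right_cancel₀ hv2 h1
  refine ⟨c, fun i => ?_⟩
  have h1 : φ (al i - C c * pderiv i F) = 0 := by
    rw [map_sub, map_mul, hg, hgc, sub_self]
  have h2 : (al i - C c * pderiv i F).IsHomogeneous (d - 1) :=
    (hal i).sub (hF.pderiv.C_mul c)
  exact sub_eq_zero.1 (not_dvd_of_lt hF h2 hF0 (by omega) ((hφ _).1 h1))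

/-- The case of degree exactly `d - 2`. -/
lemma main_case (d : ℕ) (hd : 3 ≤ d) (F : MvPolynomial (Fin 3) ℂ)
    (hF : F.IsHomogeneous d) (hirr : Irreducible F) (hnodal : Nodal F)
    (a b c : MvPolynomial (Fin 3) ℂ)
    (ha : a.IsHomogeneous (d - 2)) (hb : b.IsHomogeneous (d - 2)) (hc : c.IsHomogeneous (d - 2))
    (hsyz : a * pderiv 0 F + b * pderiv 1 F + c * pderiv 2 F = 0) :
    a = 0 ∧ b = 0 ∧ c = 0 := by
  have hF0 : F ≠ 0 := hirr.ne_zero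
  have hdF : ((d : MvPolynomial (Fin 3) ℂ)) * F ≠ 0 := by
    refine mul_ne_zero ?_ hF0
    exact_mod_cast (by omega : d ≠ 0)
  have euler := hF.sum_X_mul_pderiv
  rw [Fin.sum_univ_three, nsmul_eq_mul] at euler
  let al : Fin 3 → MvPolynomial (Fin 3) ℂ :=
    ![X 1 * c - X 2 * b, X 2 * a - X 0 * c, X 0 * b - X 1 * a]
  have r01 : pderiv 0 F * al 1 - pderiv 1 F * al 0 = - c * (d * F) := by
    simp only [al, Matrix.cons_val]
    linear_combination X 2 * hsyz - c * euler
  have r12 : pderiv 1 F * al 2 - pderiv 2 F * al 1 = - a * (d * F) := by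
    simp only [al, Matrix.cons_val]
    linear_combination X 0 * hsyz - a * euler
  have r20 : pderiv 2 F * al 0 - pderiv 0 F * al 2 = - b * (d * F) := by
    simp only [al, Matrix.cons_val]
    linear_combination X 1 * hsyz - b * euler
  have hXm : ∀ (i : Fin 3) {y : MvPolynomial (Fin 3) ℂ}, y.IsHomogeneous (d - 2) →
      (X i * y).IsHomogeneous (d - 1) := by
    intro i y hy
    have := (isHomogeneous_X ℂ i).mul hy
    rwa [show 1 + (d - 2) = d - 1 by omega] at this
  have hal : ∀ i, (al i).IsHomogeneous (d - 1) := by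
    intro i
    fin_cases i
    · exact (hXm 1 hc).sub (hXm 2 hb)
    · exact (hXm 2 ha).sub (hXm 0 hc)
    · exact (hXm 0 hb).sub (hXm 1 ha)
  have dvd_aux : ∀ y : MvPolynomial (Fin 3) ℂ, F ∣ - y * (d * F) := fun y =>
    Dvd.intro_left (-y * d) (by ring)
  have hprop : ∀ i j, F ∣ pderiv i F * al j - pderiv j F * al i := by
    have s01 := r01 ▸ dvd_aux c
    have s12 := r12 ▸ dvd_aux a
    have s20 := r20 ▸ dvd_aux b
    have hsymm : ∀ i j, F ∣ pderiv i F * al j - pderiv j F * al i →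
        F ∣ pderiv j F * al i - pderiv i F * al j := fun i j h => by
      rw [← neg_sub]; exact (dvd_neg).2 h
    have hself : ∀ i, F ∣ pderiv i F * al i - pderiv i F * al i := fun i => by simp
    intro i j
    fin_cases i <;> fin_cases j
    · exact hself 0
    · exact s01
    · exact hsymm 2 0 s20
    · exact hsymm 0 1 s01
    · exact hself 1
    · exact s12
    · exact s20
    · exact hsymm 1 2 s12
    · exact hself 2
  have hvan : ∀ i, ∀ q : Fin 3 → ℂ, q ≠ 0 → (∀ i, eval q (pderiv i F) = 0) →
      eval q (al i) = 0 := by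
    intro i q hq hs
    obtain ⟨t, ht⟩ := ker_hess hF hnodal q hq hs ![eval q a, eval q b, eval q c] (by
      intro l
      have h1 := congrArg (fun G => eval q (pderiv l G)) hsyz
      simp only [map_add, pderiv_mul, map_mul, hs, mul_zero, zero_add, map_zero] at h1
      rw [Fin.sum_univ_three]
      simp only [Matrix.cons_val]
      linear_combination h1)
    have t0 : eval q a = t * q 0 := by simpa using congrFun ht 0
    have t1 : eval q b = t * q 1 := by simpa using congrFun ht 1
    have t2 : eval q c = t * q 2 := by simpa using congrFun ht 2
    fin_cases i
    · simp [al, t1, t2]; ring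
    · simp [al, t0, t2]; ring
    · simp [al, t0, t1]; ring
  choose N hN using fun i => exists_pow_sat hF hnodal (hal i) (hvan i)
  obtain ⟨t, ht⟩ := eigen hd hF hirr al hal hprop (N 0 + N 1 + N 2) (by
    intro i
    refine hN i _ ?_
    fin_cases i <;> simp <;> omega)
  have ht0 : (C t : MvPolynomial (Fin 3) ℂ) = 0 := by
    have h0 : X 0 * al 0 + X 1 * al 1 + X 2 * al 2 = 0 := by
      simp only [al, Matrix.cons_val]
      ring
    rw [ht 0, ht 1, ht 2] at h0
    have h1 : C t * ((d : MvPolynomial (Fin 3) ℂ) * F) = 0 := by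
      linear_combination h0 - C t * euler
    exact (mul_eq_zero.1 h1).resolve_right hdF
  have hal0 : ∀ i, al i = 0 := fun i => by rw [ht i, ht0, zero_mul]
  simp only [hal0, mul_zero, sub_self] at r01 r12 r20
  refine ⟨?_, ?_, ?_⟩
  · simpa using (mul_eq_zero.1 r12.symm).resolve_right hdF
  · simpa using (mul_eq_zero.1 r20.symm).resolve_right hdF
  · simpa using (mul_eq_zero.1 r01.symm).resolve_right hdF

theorem stmt_8 (d : ℕ) (hd : 3 ≤ d) (F : MvPolynomial (Fin 3) ℂ)
    (hF : F.IsHomogeneous d) (hirr : Irreducible F) (hnodal : Nodal F)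
    (m : ℕ) (hm : m ≤ d - 2) (a b c : MvPolynomial (Fin 3) ℂ)
    (ha : a.IsHomogeneous m) (hb : b.IsHomogeneous m) (hc : c.IsHomogeneous m)
    (hsyz : a * pderiv 0 F + b * pderiv 1 F + c * pderiv 2 F = 0) :
    a = 0 ∧ b = 0 ∧ c = 0 := by
  have hX : ∀ {y : MvPolynomial (Fin 3) ℂ}, y.IsHomogeneous m →
      (X 0 ^ (d - 2 - m) * y).IsHomogeneous (d - 2) := by
    intro y hy
    have := (isHomogeneous_X_pow (R := ℂ) (0 : Fin 3) (d - 2 - m)).mul hy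
    rwa [show d - 2 - m + m = d - 2 by omega] at this
  have hX0 : (X 0 : MvPolynomial (Fin 3) ℂ) ^ (d - 2 - m) ≠ 0 := pow_ne_zero _ (X_ne_zero _)
  obtain ⟨h1, h2, h3⟩ := main_case d hd F hF hirr hnodal _ _ _ (hX ha) (hX hb) (hX hc)
    (by linear_combination X 0 ^ (d - 2 - m) * hsyz)
  exact ⟨(mul_eq_zero.1 h1).resolve_left hX0, (mul_eq_zero.1 h2).resolve_left hX0,
    (mul_eq_zero.1 h3).resolve_left hX0⟩

end
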